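/- Let η : ℝ² → ℝ be a smooth function whose support is contained in the closed unit disk. Then for every (φ, ψ) ∈ [0, 2π) × (0, π/2), the transverse V-line transform of the gradient field dη := (∂η/∂x₁, ∂η/∂x₂) satisfies T(dη)(φ, ψ) = −(∂/∂s)[Rη(s, φ − ψ + π/2) − Rη(s, φ + ψ − π/2)] evaluated at s = sin ψ. -/

import Mathlib

open Real MeasureTheory Set

noncomputable section

/-- The unit vector at polar angle `θ`. -/
def Phi (θ : ℝ) : ℝ × ℝ := (Real.cos θ, Real.sin θ)

/-- Rotation of a vector by 90° counterclockwise. -/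
def perp (w : ℝ × ℝ) : ℝ × ℝ := (-w.2, w.1)

/-- Euclidean dot product on `ℝ × ℝ`. -/
def dot (a b : ℝ × ℝ) : ℝ := a.1 * b.1 + a.2 * b.2

/-- The open unit disk in the plane. -/
def unitDisk : Set (ℝ × ℝ) := {x | x.1 ^ 2 + x.2 ^ 2 < 1}

/-- The closed unit disk in the plane. -/
def closedUnitDisk : Set (ℝ × ℝ) := {x | x.1 ^ 2 + x.2 ^ 2 ≤ 1}

/-- The unit circle in the plane. -/
def unitCircle : Set (ℝ × ℝ) := {x | x.1 ^ 2 + x.2 ^ 2 = 1}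

/-- The Radon transform of a scalar function. -/
def radon (h : ℝ × ℝ → ℝ) (s θ : ℝ) : ℝ :=
  ∫ t : ℝ, h (s • Phi θ + t • Phi (θ + π / 2))

/-- The weighted V-line transform of a scalar function, with weights `c₁, c₂`. -/
def Vw (c₁ c₂ : ℝ) (h : ℝ × ℝ → ℝ) (φ ψ : ℝ) : ℝ :=
  c₁ * (∫ t in Ioi (0 : ℝ), h (Phi φ + t • Phi (π + φ - ψ))) +
  c₂ * (∫ t in Ioi (0 : ℝ), h (Phi φ + t • Phi (π + φ + ψ)))

/-- The `n`-th (complex) Fourier coefficient of a function of the angular variable. -/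
def fourierCoeff' (g : ℝ → ℝ) (n : ℤ) : ℂ :=
  (1 / (2 * (π : ℂ))) * ∫ φ in (0 : ℝ)..(2 * π), (g φ : ℂ) * Complex.exp (-Complex.I * n * φ)

/-- The gradient `dV = (∂V/∂x₁, ∂V/∂x₂)` of a scalar function. -/
def grad (V : ℝ × ℝ → ℝ) (x : ℝ × ℝ) : ℝ × ℝ :=
  (fderiv ℝ V x (1, 0), fderiv ℝ V x (0, 1))

/-- The orthogonal gradient `d⊥V = (−∂V/∂x₂, ∂V/∂x₁)` of a scalar function. -/
def gradPerp (V : ℝ × ℝ → ℝ) (x : ℝ × ℝ) : ℝ × ℝ :=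
  (-(fderiv ℝ V x (0, 1)), fderiv ℝ V x (1, 0))

/-- The longitudinal V-line transform of a vector field. -/
def Lvec (f : ℝ × ℝ → ℝ × ℝ) (φ ψ : ℝ) : ℝ :=
  (∫ t in Ioi (0 : ℝ), dot (Phi (π + φ - ψ)) (f (Phi φ + t • Phi (π + φ - ψ)))) +
  (∫ t in Ioi (0 : ℝ), dot (Phi (π + φ + ψ)) (f (Phi φ + t • Phi (π + φ + ψ))))

/-- The transverse V-line transform of a vector field. -/
def Tvec (f : ℝ × ℝ → ℝ × ℝ) (φ ψ : ℝ) : ℝ :=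
  (∫ t in Ioi (0 : ℝ), dot (perp (Phi (π + φ - ψ))) (f (Phi φ + t • Phi (π + φ - ψ)))) +
  (∫ t in Ioi (0 : ℝ), dot (perp (Phi (π + φ + ψ))) (f (Phi φ + t • Phi (π + φ + ψ))))

/-- The `k`-th moment longitudinal V-line transform of a vector field. -/
def LvecMoment (k : ℕ) (f : ℝ × ℝ → ℝ × ℝ) (φ ψ : ℝ) : ℝ :=
  (∫ t in Ioi (0 : ℝ), t ^ k * dot (Phi (π + φ - ψ)) (f (Phi φ + t • Phi (π + φ - ψ)))) +
  (∫ t in Ioi (0 : ℝ), t ^ k * dot (Phi (π + φ + ψ)) (f (Phi φ + t • Phi (π + φ + ψ))))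

lemma dot_grad_eq_fderiv (η : ℝ × ℝ → ℝ) (w x : ℝ × ℝ) : dot w (grad η x) = fderiv ℝ η x w := by
  have h : w = w.1 • ((1 : ℝ), (0 : ℝ)) + w.2 • ((0 : ℝ), (1 : ℝ)) := by ext <;> simp
  conv_rhs => rw [h, map_add, map_smul, map_smul]
  rfl

lemma isClosed_closedUnitDisk : IsClosed closedUnitDisk :=
  isClosed_le (by fun_prop) continuous_const

lemma isCompact_closedUnitDisk : IsCompact closedUnitDisk := by
  refine (isCompact_Icc (a := ((-1 : ℝ), (-1 : ℝ))) (b := (1, 1))).of_isClosed_subset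
    isClosed_closedUnitDisk ?_
  rintro ⟨x, y⟩ h
  simp only [closedUnitDisk, mem_ofPred_eq] at h
  refine ⟨⟨?_, ?_⟩, ⟨?_, ?_⟩⟩ <;> simp only <;> nlinarith

lemma fderiv_eq_zero_of_notMem_closedUnitDisk {η : ℝ × ℝ → ℝ}
    (hsupp : Function.support η ⊆ closedUnitDisk) {x : ℝ × ℝ} (hx : x ∉ closedUnitDisk) :
    fderiv ℝ η x = 0 := by
  by_contra h
  exact hx (closure_minimal hsupp isClosed_closedUnitDisk (support_fderiv_subset ℝ h))

lemma Phi_add_pi_div_two (θ : ℝ) : Phi (θ + π / 2) = (-Real.sin θ, Real.cos θ) := by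
  simp [Phi, Real.cos_add_pi_div_two, Real.sin_add_pi_div_two]

lemma smul_Phi_add_smul_Phi_mem_closedUnitDisk_iff (s t θ : ℝ) :
    s • Phi θ + t • Phi (θ + π / 2) ∈ closedUnitDisk ↔ s ^ 2 + t ^ 2 ≤ 1 := by
  have h : (s * Real.cos θ + t * -Real.sin θ) ^ 2 + (s * Real.sin θ + t * Real.cos θ) ^ 2
      = s ^ 2 + t ^ 2 := by linear_combination (s ^ 2 + t ^ 2) * Real.sin_sq_add_cos_sq θ
  rw [Phi_add_pi_div_two]
  simp [closedUnitDisk, Phi, -mul_neg, h]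

/-- Differentiation of the Radon transform under the integral sign. -/
lemma hasDerivAt_radon {η : ℝ × ℝ → ℝ} (hη : ContDiff ℝ 1 η)
    (hsupp : Function.support η ⊆ closedUnitDisk) (s θ : ℝ) :
    HasDerivAt (fun s => radon η s θ)
      (∫ t : ℝ, fderiv ℝ η (s • Phi θ + t • Phi (θ + π / 2)) (Phi θ)) s := by
  have hcont : Continuous fun x => fderiv ℝ η x (Phi θ) :=
    (hη.continuous_fderiv one_ne_zero).clm_apply continuous_const
  obtain ⟨C, hC⟩ := isCompact_closedUnitDisk.exists_bound_of_continuousOn hcont.continuousOn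
  have hline : ∀ s : ℝ, Continuous fun t : ℝ => s • Phi θ + t • Phi (θ + π / 2) := by
    intro s; fun_prop
  have hsq : ∀ {s t : ℝ}, s • Phi θ + t • Phi (θ + π / 2) ∈ closedUnitDisk → t ∈ Icc (-1 : ℝ) 1 := by
    intro s t h
    rw [smul_Phi_add_smul_Phi_mem_closedUnitDisk_iff] at h
    constructor <;> nlinarith [sq_nonneg s]
  refine (hasDerivAt_integral_of_dominated_loc_of_deriv_le (μ := volume)
    (F := fun s t => η (s • Phi θ + t • Phi (θ + π / 2)))
    (F' := fun s t => fderiv ℝ η (s • Phi θ + t • Phi (θ + π / 2)) (Phi θ))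
    (bound := (Icc (-1 : ℝ) 1).indicator fun _ => C) Filter.univ_mem
    (.of_forall fun s => (hη.continuous.comp (hline s)).aestronglyMeasurable) ?_
    (hcont.comp (hline s)).aestronglyMeasurable ?_ ?_ ?_).2
  · refine (hη.continuous.comp (hline s)).integrable_of_hasCompactSupport ?_
    refine HasCompactSupport.intro (isCompact_Icc (a := (-1 : ℝ)) (b := 1)) fun t ht => ?_
    by_contra h
    exact ht (hsq (hsupp h))
  · refine .of_forall fun t s _ => ?_
    by_cases hx : s • Phi θ + t • Phi (θ + π / 2) ∈ closedUnitDisk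
    · rw [indicator_of_mem (hsq hx)]
      exact hC _ hx
    · rw [fderiv_eq_zero_of_notMem_closedUnitDisk hsupp hx]
      have h0 : (0 : ℝ) ≤ C := (norm_nonneg _).trans (hC (0, 0) (by simp [closedUnitDisk]))
      simpa using indicator_nonneg (fun _ _ => h0) t
  · exact (integrable_indicator_iff measurableSet_Icc).2 (by simp)
  · refine .of_forall fun t s _ => ?_
    have h1 : HasDerivAt (fun s : ℝ => s • Phi θ + t • Phi (θ + π / 2)) (Phi θ) s := by
      simpa using ((hasDerivAt_id s).smul_const (Phi θ)).add_const (t • Phi (θ + π / 2))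
    exact ((hη.differentiable one_ne_zero _).hasFDerivAt).comp_hasDerivAt s h1

/-- A function supported in the disk has the same integral over a ray entering the disk from
the circle as over the whole line. -/
lemma integral_Ioi_eq_integral_of_support_subset {g : ℝ × ℝ → ℝ}
    (hg : ∀ x ∉ closedUnitDisk, g x = 0) {p w : ℝ × ℝ} (hp : p ∈ unitCircle)
    (hw : w ∈ unitCircle) (hpw : dot p w ≤ 0) :
    ∫ t in Ioi (0 : ℝ), g (p + t • w) = ∫ t : ℝ, g (p + t • w) := by
  rw [← integral_Ici_eq_integral_Ioi]
  refine setIntegral_eq_integral_of_forall_compl_eq_zero fun t ht => hg _ ?_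
  simp only [unitCircle, mem_ofPred_eq, dot, mem_Ici, not_le] at *
  simp only [closedUnitDisk, mem_ofPred_eq, Prod.fst_add, Prod.snd_add, Prod.smul_fst,
    Prod.smul_snd, smul_eq_mul, not_le]
  have h := mul_nonneg_of_nonpos_of_nonpos ht.le hpw
  have h2 : (p.1 + t * w.1) ^ 2 + (p.2 + t * w.2) ^ 2
      = 1 + t ^ 2 + 2 * (t * (p.1 * w.1 + p.2 * w.2)) := by
    linear_combination hp + t ^ 2 * hw
  nlinarith [sq_pos_of_neg ht]

lemma Phi_mem_unitCircle (θ : ℝ) : Phi θ ∈ unitCircle := Real.cos_sq_add_sin_sq θ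

lemma dot_Phi_Phi (α β : ℝ) : dot (Phi α) (Phi β) = Real.cos (α - β) := (Real.cos_sub α β).symm

lemma perp_Phi (θ : ℝ) : perp (Phi θ) = Phi (θ + π / 2) := by
  rw [Phi_add_pi_div_two]; rfl

lemma Phi_add_pi (θ : ℝ) : Phi (θ + π) = -Phi θ := by
  simp [Phi]

lemma Phi_eq_smul_add_smul (φ θ : ℝ) :
    Phi φ = Real.cos (φ - θ) • Phi θ + Real.sin (φ - θ) • Phi (θ + π / 2) := by
  rw [Phi_add_pi_div_two]
  obtain ⟨a, rfl⟩ : ∃ a, φ = a + θ := ⟨φ - θ, by ring⟩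
  ext <;> simp [Phi, Real.cos_add, Real.sin_add] <;> ring

lemma integral_line_add (g : ℝ × ℝ → ℝ) (s c : ℝ) (v w : ℝ × ℝ) :
    ∫ t : ℝ, g ((s • v + c • w) + t • w) = ∫ t : ℝ, g (s • v + t • w) := by
  rw [← integral_add_left_eq_self (fun t => g (s • v + t • w)) c]
  simp only [add_smul, add_assoc]

lemma integral_line_sub (g : ℝ × ℝ → ℝ) (s c : ℝ) (v w : ℝ × ℝ) :
    ∫ t : ℝ, g ((s • v + c • w) + t • -w) = ∫ t : ℝ, g (s • v + t • w) := by
  rw [← integral_line_add g s c, ← integral_neg_eq_self]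
  simp only [smul_neg, neg_smul, neg_neg]

/-- the transverse V-line transform of `dη` via the Radon transform of `η`. -/
theorem Tvec_grad_eq (η : ℝ × ℝ → ℝ) (hsm : ContDiff ℝ (⊤ : ℕ∞) η)
    (hsupp : Function.support η ⊆ closedUnitDisk)
    (φ ψ : ℝ) (hφ : φ ∈ Ico 0 (2 * π)) (hψ : ψ ∈ Ioo 0 (π / 2)) :
    Tvec (grad η) φ ψ =
      -deriv (fun s => radon η s (φ - ψ + π / 2) - radon η s (φ + ψ - π / 2)) (Real.sin ψ) := by
  have hη : ContDiff ℝ 1 η := hsm.of_le (by exact_mod_cast le_top)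
  have hcos : 0 ≤ Real.cos ψ :=
    Real.cos_nonneg_of_mem_Icc ⟨by linarith [hψ.1, Real.pi_pos], hψ.2.le⟩
  have hray : ∀ v w : ℝ × ℝ, w ∈ unitCircle → dot (Phi φ) w ≤ 0 →
      ∫ t in Ioi (0 : ℝ), fderiv ℝ η (Phi φ + t • w) v = ∫ t : ℝ, fderiv ℝ η (Phi φ + t • w) v :=
    fun v w hw hpw => integral_Ioi_eq_integral_of_support_subset (g := fun x => fderiv ℝ η x v)
      (fun x hx => by simp [fderiv_eq_zero_of_notMem_closedUnitDisk hsupp hx])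
      (Phi_mem_unitCircle φ) hw hpw
  rw [((hasDerivAt_radon hη hsupp _ _).fun_sub (hasDerivAt_radon hη hsupp _ _)).deriv]
  simp only [Tvec, dot_grad_eq_fderiv]
  rw [hray _ _ (Phi_mem_unitCircle _) (by
      rw [dot_Phi_Phi, show φ - (π + φ - ψ) = ψ - π by ring, Real.cos_sub_pi]; linarith),
    hray _ _ (Phi_mem_unitCircle _) (by
      rw [dot_Phi_Phi, show φ - (π + φ + ψ) = -(ψ + π) by ring, Real.cos_neg, Real.cos_add_pi]
      linarith)]
  have h1 : ∫ t : ℝ, fderiv ℝ η (Phi φ + t • Phi (π + φ - ψ)) (perp (Phi (π + φ - ψ))) =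
      -∫ t : ℝ, fderiv ℝ η (Real.sin ψ • Phi (φ - ψ + π / 2) + t • Phi (φ - ψ + π / 2 + π / 2))
        (Phi (φ - ψ + π / 2)) := by
    rw [perp_Phi, show π + φ - ψ + π / 2 = φ - ψ + π / 2 + π by ring, Phi_add_pi,
      show π + φ - ψ = φ - ψ + π / 2 + π / 2 by ring, Phi_eq_smul_add_smul φ (φ - ψ + π / 2),
      show φ - (φ - ψ + π / 2) = ψ - π / 2 by ring, Real.cos_sub_pi_div_two]
    simp only [map_neg, integral_neg]
    rw [integral_line_add (fun x => fderiv ℝ η x (Phi (φ - ψ + π / 2)))]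
  have h2 : ∫ t : ℝ, fderiv ℝ η (Phi φ + t • Phi (π + φ + ψ)) (perp (Phi (π + φ + ψ))) =
      ∫ t : ℝ, fderiv ℝ η (Real.sin ψ • Phi (φ + ψ - π / 2) + t • Phi (φ + ψ - π / 2 + π / 2))
        (Phi (φ + ψ - π / 2)) := by
    rw [perp_Phi, show π + φ + ψ + π / 2 = φ + ψ - π / 2 + π + π by ring, Phi_add_pi, Phi_add_pi,
      neg_neg, show π + φ + ψ = φ + ψ - π / 2 + π / 2 + π by ring, Phi_add_pi,
      Phi_eq_smul_add_smul φ (φ + ψ - π / 2),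
      show φ - (φ + ψ - π / 2) = π / 2 - ψ by ring, Real.cos_pi_div_two_sub]
    exact integral_line_sub (fun x => fderiv ℝ η x (Phi (φ + ψ - π / 2))) _ _ _ _
  rw [h1, h2]
  ring
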